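/- Let n ≥ 4 and m ≥ 4, and suppose f is an anonymous, neutral, sd-efficient, and sd-strategyproof SDS for n agents and a set A of m alternatives. Fix a 4-element subset A' ⊆ A. Define an SDS f' for 4 agents and alternatives A' as follows: for each 4-agent profile R' on A', let f'(R') = f(R), where R is the n-agent profile on A in which agents 1–4 rank all of A' above all of A ∖ A' with their preferences on A' as in R' (and some fixed ordering of A ∖ A' below), and agents 5,...,n are completely indifferent among all alternatives of A. Then f' is well-defined (f(R) places all probability on A'), and f' is anonymous, neutral, sd-efficient, and sd-strategyproof. -/

import Mathlib

open Finset
open scoped Classical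

section Framework

variable {A : Type*} [Fintype A] {n : ℕ}

/-- `p` is a lottery (probability distribution) on the set of alternatives `A`. -/
def IsLottery (p : A → ℝ) : Prop := (∀ x, 0 ≤ p x) ∧ ∑ x, p x = 1

/-- `r` is a weak preference relation: complete (total) and transitive. -/
def IsPref (r : A → A → Prop) : Prop := Total r ∧ Transitive r

/-- A preference profile assigns a weak preference relation to each of the `n` agents. -/
def IsProfile (R : Fin n → A → A → Prop) : Prop := ∀ i, IsPref (R i)

/-- The probability that `p` assigns to alternatives weakly preferred (by `r`) to `x`. -/
noncomputable def upperProb (r : A → A → Prop) (p : A → ℝ) (x : A) : ℝ :=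
  ∑ y ∈ univ.filter (fun y => r y x), p y

/-- Stochastic dominance: `p ≽^sd q` w.r.t. the preference relation `r`. -/
def SDge (r : A → A → Prop) (p q : A → ℝ) : Prop :=
  ∀ x, upperProb r q x ≤ upperProb r p x

/-- Strict stochastic dominance: `p ≻^sd q` w.r.t. the preference relation `r`. -/
def SDgt (r : A → A → Prop) (p q : A → ℝ) : Prop :=
  SDge r p q ∧ ¬ SDge r q p

/-- A social decision scheme maps every preference profile to a lottery. -/
def IsSDS (f : (Fin n → A → A → Prop) → (A → ℝ)) : Prop :=
  ∀ R : Fin n → A → A → Prop, IsProfile R → IsLottery (f R)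

/-- Anonymity: invariance under permutations of the agents. -/
def Anonymous (f : (Fin n → A → A → Prop) → (A → ℝ)) : Prop :=
  ∀ R : Fin n → A → A → Prop, IsProfile R → ∀ π : Equiv.Perm (Fin n),
    f (fun i => R (π i)) = f R

/-- Neutrality: `f(R^σ)(σ x) = f(R)(x)`, where `R^σ` relabels alternatives by `σ`
(i.e. `σ x ≽^σ_i σ y ↔ x ≽_i y`). -/
def Neutral (f : (Fin n → A → A → Prop) → (A → ℝ)) : Prop :=
  ∀ R : Fin n → A → A → Prop, IsProfile R → ∀ σ : Equiv.Perm A, ∀ x : A,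
    f (fun i u v => R i (σ.symm u) (σ.symm v)) (σ x) = f R x

/-- The lottery `p` is sd-efficient for the profile `R`: no lottery `q` is weakly
sd-preferred to `p` by all agents and strictly sd-preferred by some agent. -/
def SDEfficientLottery (R : Fin n → A → A → Prop) (p : A → ℝ) : Prop :=
  ¬ ∃ q : A → ℝ, IsLottery q ∧ (∀ i, SDge (R i) q p) ∧ (∃ i, SDgt (R i) q p)

/-- sd-efficiency of a social decision scheme. -/
def SDEfficient (f : (Fin n → A → A → Prop) → (A → ℝ)) : Prop :=
  ∀ R : Fin n → A → A → Prop, IsProfile R → SDEfficientLottery R (f R)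

/-- sd-strategyproofness: no agent can misreport and obtain a strictly
sd-preferred lottery. -/
def SDStrategyproof (f : (Fin n → A → A → Prop) → (A → ℝ)) : Prop :=
  ∀ R R' : Fin n → A → A → Prop, IsProfile R → IsProfile R' → ∀ i : Fin n,
    (∀ j, j ≠ i → R j = R' j) → ¬ SDgt (R i) (f R') (f R)

/-- `x` is the unique most-preferred alternative of the relation `r`. -/
def UniqueTop (r : A → A → Prop) (x : A) : Prop :=
  ∀ y, y ≠ x → r x y ∧ ¬ r y x

/-- `f` extends random dictatorship: whenever every agent has a unique top choice,
each alternative gets probability (number of agents having it as top)/n. -/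
def ExtendsRD (f : (Fin n → A → A → Prop) → (A → ℝ)) : Prop :=
  ∀ R : Fin n → A → A → Prop, IsProfile R →
    ∀ t : Fin n → A, (∀ i, UniqueTop (R i) (t i)) →
      ∀ x : A, f R x = ((univ.filter (fun i => t i = x)).card : ℝ) / (n : ℝ)

/-- `x` is Pareto-dominated in the profile `R`. -/
def Pareto_Dominated (R : Fin n → A → A → Prop) (x : A) : Prop :=
  ∃ y : A, (∀ i, R i y x) ∧ ∃ i, R i y x ∧ ¬ R i x y

end Framework

section Reduction

variable {A : Type*} [Fintype A] {n : ℕ}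

/-- Extension of a 4-agent profile `R'` on the subset `A'` to an `n`-agent profile on `A`:
the first four agents rank all of `A'` (ordered as in `R'`) above all of `A ∖ A'`
(ordered there by the fixed ordering `ord`), and all remaining agents are completely
indifferent among all alternatives. -/
def extProfile (A' : Finset A) (ord : A → A → Prop)
    (R' : Fin 4 → {x : A // x ∈ A'} → {x : A // x ∈ A'} → Prop) :
    Fin n → A → A → Prop :=
  fun i x y =>
    if h : (i : ℕ) < 4 then
      (∃ hx : x ∈ A', ∃ hy : y ∈ A', R' ⟨(i : ℕ), h⟩ ⟨x, hx⟩ ⟨y, hy⟩) ∨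
      (x ∈ A' ∧ y ∉ A') ∨
      (x ∉ A' ∧ y ∉ A' ∧ ord x y)
    else True

/-- The SDS `f'` for 4 agents and the alternatives `A'` obtained from `f` by
restricting `f` applied to the extended profile. -/
noncomputable def restrictSDS (f : (Fin n → A → A → Prop) → (A → ℝ))
    (A' : Finset A) (ord : A → A → Prop)
    (R' : Fin 4 → {x : A // x ∈ A'} → {x : A // x ∈ A'} → Prop) :
    {x : A // x ∈ A'} → ℝ :=
  fun x => f (extProfile A' ord R') x.1

/-- An alternative that is Pareto-dominated gets probability zero in every sd-efficient lottery. -/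
theorem SDEfficientLottery.apply_eq_zero {R : Fin n → A → A → Prop} {p : A → ℝ}
    (hR : IsProfile R) (hp : IsLottery p) (h : SDEfficientLottery R p) {x : A}
    (hx : Pareto_Dominated R x) : p x = 0 := by
  by_contra hne
  obtain ⟨a, ha, i, hai, hxi⟩ := hx
  have hpos : 0 < p x := lt_of_le_of_ne (hp.1 x) (Ne.symm hne)
  have hax : a ≠ x := by rintro rfl; exact hxi hai
  let q : A → ℝ := fun y => p y + ((if y = a then p x else 0) - if y = x then p x else 0)
  have hupper (r : A → A → Prop) (z : A) : upperProb r q z =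
      upperProb r p z + ((if r a z then p x else 0) - if r x z then p x else 0) := by
    simp [upperProb, q, Finset.sum_add_distrib, Finset.sum_sub_distrib]
  have hge (j : Fin n) : SDge (R j) q p := by
    intro z
    rw [hupper]
    by_cases hxz : R j x z
    · simp [hxz, (hR j).2 (ha j) hxz]
    · by_cases haz : R j a z <;> simp [hxz, haz, hpos.le]
  refine h ⟨q, ⟨fun y => ?_, ?_⟩, hge, i, hge i, fun hle => ?_⟩
  · have := hp.1 y
    by_cases hya : y = a
    · subst hya
      simp only [q, if_pos, if_neg hax]
      linarith
    · by_cases hyx : y = x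
      · subst hyx
        simp [q, hya]
      · simpa [q, hya, hyx] using this
  · simp [q, Finset.sum_add_distrib, Finset.sum_sub_distrib, hp.2]
  · have hle := hle a
    have haa : R i a a := (or_self_iff.1 ((hR i).1 a a))
    rw [hupper, if_pos haa, if_neg hxi] at hle
    linarith

section ExtProfile

variable {A : Type*} {A' : Finset A} {ord : A → A → Prop}
  {R' : Fin 4 → {x : A // x ∈ A'} → {x : A // x ∈ A'} → Prop}

theorem extProfile_of_le {i : Fin n} (h : 4 ≤ (i : ℕ)) (x y : A) :
    extProfile A' ord R' i x y := by
  simp [extProfile, not_lt.2 h]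

theorem extProfile_coe_coe {i : Fin n} (h : (i : ℕ) < 4) (x y : {x : A // x ∈ A'}) :
    extProfile A' ord R' i x y ↔ R' ⟨i, h⟩ x y := by
  simp [extProfile, h]

theorem extProfile_mem_notMem {i : Fin n} {x y : A} (hx : x ∈ A') (hy : y ∉ A') :
    extProfile A' ord R' i x y := by
  simp [extProfile, hx, hy]

theorem not_extProfile_notMem_mem {i : Fin n} (h : (i : ℕ) < 4) {x y : A} (hx : x ∉ A')
    (hy : y ∈ A') : ¬ extProfile A' ord R' i x y := by
  simp [extProfile, h, hx, hy]

theorem extProfile_notMem_notMem {i : Fin n} (h : (i : ℕ) < 4) {x y : A} (hx : x ∉ A')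
    (hy : y ∉ A') : extProfile A' ord R' i x y ↔ ord x y := by
  simp [extProfile, h, hx, hy]

theorem isProfile_extProfile (hord : IsPref ord) (hR' : IsProfile R') :
    IsProfile (extProfile (n := n) A' ord R') := by
  intro i
  by_cases h : (i : ℕ) < 4
  · refine ⟨fun x y => ?_, fun x y z hxy hyz => ?_⟩
    · by_cases hx : x ∈ A' <;> by_cases hy : y ∈ A'
      · simpa only [← extProfile_coe_coe (ord := ord) h] using
          (hR' ⟨i, h⟩).1 ⟨x, hx⟩ ⟨y, hy⟩
      · exact .inl (extProfile_mem_notMem hx hy)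
      · exact .inr (extProfile_mem_notMem hy hx)
      · simpa only [extProfile_notMem_notMem h, hx, hy, not_false_eq_true] using
          hord.1 x y
    · by_cases hz : z ∈ A'
      · have hy : y ∈ A' := by
          by_contra hy; exact not_extProfile_notMem_mem h hy hz hyz
        have hx : x ∈ A' := by
          by_contra hx; exact not_extProfile_notMem_mem h hx hy hxy
        lift x to {x // x ∈ A'} using hx
        lift y to {x // x ∈ A'} using hy
        lift z to {x // x ∈ A'} using hz
        rw [extProfile_coe_coe h] at *
        exact (hR' ⟨i, h⟩).2 hxy hyz
      · by_cases hx : x ∈ A'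
        · exact extProfile_mem_notMem hx hz
        · have hy : y ∉ A' := fun hy => not_extProfile_notMem_mem h hx hy hxy
          rw [extProfile_notMem_notMem h] at * <;> try assumption
          exact hord.2 hxy hyz
  · have h := not_lt.1 h
    exact ⟨fun x y => .inl (extProfile_of_le h x y), fun x y z _ _ => extProfile_of_le h x z⟩

theorem extProfile_comp_perm (hn : 4 ≤ n) (π : Equiv.Perm (Fin 4)) :
    ∃ τ : Equiv.Perm (Fin n), (extProfile A' ord (fun i => R' (π i)) : Fin n → A → A → Prop) =
      fun i => extProfile A' ord R' (τ i) := by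
  let e : Fin 4 ≃ {i : Fin n // (i : ℕ) < 4} :=
    { toFun i := ⟨Fin.castLE hn i, i.2⟩
      invFun i := ⟨i.1, i.2⟩
      left_inv _ := rfl
      right_inv _ := rfl }
  refine ⟨π.extendDomain e, funext fun i => ?_⟩
  by_cases h : (i : ℕ) < 4
  · have : π.extendDomain e i = Fin.castLE hn (π ⟨i, h⟩) := π.extendDomain_apply_subtype e h
    funext x y
    simp [extProfile, this, h]
  · rw [π.extendDomain_apply_not_subtype e h]
    funext x y
    simp [extProfile, h]

theorem extProfile_relabel (σ : Equiv.Perm {x : A // x ∈ A'}) :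
    (extProfile A' ord (fun i u v => R' i (σ.symm u) (σ.symm v)) : Fin n → A → A → Prop) =
      fun i u v => extProfile A' ord R' i ((Equiv.Perm.ofSubtype σ).symm u)
        ((Equiv.Perm.ofSubtype σ).symm v) := by
  have hsymm : (Equiv.Perm.ofSubtype σ).symm = Equiv.Perm.ofSubtype σ.symm :=
    (map_inv Equiv.Perm.ofSubtype σ).symm
  have hmem (u : {x : A // x ∈ A'}) : Equiv.Perm.ofSubtype σ.symm u = (σ.symm u : A) :=
    Equiv.Perm.ofSubtype_apply_coe _ u
  have hnot {u : A} (hu : u ∉ A') : Equiv.Perm.ofSubtype σ.symm u = u :=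
    Equiv.Perm.ofSubtype_apply_of_not_mem _ hu
  funext i u v
  rw [hsymm, eq_iff_iff]
  by_cases h : (i : ℕ) < 4
  · by_cases hu : u ∈ A' <;> by_cases hv : v ∈ A'
    · lift u to {x // x ∈ A'} using hu
      lift v to {x // x ∈ A'} using hv
      rw [hmem, hmem, extProfile_coe_coe h, extProfile_coe_coe h]
    · lift u to {x // x ∈ A'} using hu
      rw [hmem, hnot hv]
      exact iff_of_true (extProfile_mem_notMem u.2 hv) (extProfile_mem_notMem (σ.symm u).2 hv)
    · lift v to {x // x ∈ A'} using hv
      rw [hmem, hnot hu]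
      exact iff_of_false (not_extProfile_notMem_mem h hu v.2)
        (not_extProfile_notMem_mem h hu (σ.symm v).2)
    · rw [hnot hu, hnot hv, extProfile_notMem_notMem h hu hv, extProfile_notMem_notMem h hu hv]
  · exact iff_of_true (extProfile_of_le (not_lt.1 h) _ _) (extProfile_of_le (not_lt.1 h) _ _)

end ExtProfile

section RestrictedLottery

variable {A' : Finset A} {ord : A → A → Prop}
  {R' : Fin 4 → {x : A // x ∈ A'} → {x : A // x ∈ A'} → Prop}

theorem sum_coe_eq_sum {p : A → ℝ} (hp : ∀ x ∉ A', p x = 0) :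
    ∑ x : {x : A // x ∈ A'}, p x = ∑ x, p x := by
  rw [← Finset.sum_subtype A' (fun _ => Iff.rfl) p]
  exact Finset.sum_subset (Finset.subset_univ _) fun x _ hx => hp x hx

theorem IsLottery.restrict {p : A → ℝ} (hp : IsLottery p) (hp0 : ∀ x ∉ A', p x = 0) :
    IsLottery fun x : {x : A // x ∈ A'} => p x :=
  ⟨fun x => hp.1 x, (sum_coe_eq_sum hp0).trans hp.2⟩

theorem upperProb_eq_one {r : A → A → Prop} {p : A → ℝ} {x : A} (hp : IsLottery p)
    (h : ∀ y, p y ≠ 0 → r y x) : upperProb r p x = 1 := by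
  rw [← hp.2, upperProb, Finset.sum_filter_of_ne fun y _ => h y]

theorem upperProb_extProfile_coe {p : A → ℝ} (hp : ∀ x ∉ A', p x = 0) {i : Fin n}
    (h : (i : ℕ) < 4) (x : {x : A // x ∈ A'}) :
    upperProb (extProfile A' ord R' i) p x =
      upperProb (R' ⟨i, h⟩) (fun y : {x : A // x ∈ A'} => p y) x := by
  simp only [upperProb, Finset.sum_filter]
  rw [← sum_coe_eq_sum (A' := A') fun y hy => by simp [hp y hy]]
  simp only [extProfile_coe_coe h]

theorem sdGe_extProfile_of_le {p q : A → ℝ} (hp : IsLottery p) (hq : IsLottery q)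
    {i : Fin n} (h : 4 ≤ (i : ℕ)) : SDge (extProfile A' ord R' i) p q := by
  intro x
  rw [upperProb_eq_one hp fun y _ => extProfile_of_le h y x,
    upperProb_eq_one hq fun y _ => extProfile_of_le h y x]

/-- For lotteries supported on `A'`, the first four agents of the extended profile compare
lotteries in the same way as the agents of the original profile. -/
theorem sdGe_extProfile_iff {p q : A → ℝ} (hp : IsLottery p) (hq : IsLottery q)
    (hp0 : ∀ x ∉ A', p x = 0) (hq0 : ∀ x ∉ A', q x = 0) {i : Fin n} (h : (i : ℕ) < 4) :
    SDge (extProfile A' ord R' i) p q ↔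
      SDge (R' ⟨i, h⟩) (fun y : {x : A // x ∈ A'} => p y) (fun y => q y) := by
  refine ⟨fun H x => ?_, fun H x => ?_⟩
  · simpa only [upperProb_extProfile_coe hp0 h, upperProb_extProfile_coe hq0 h] using H x
  · by_cases hx : x ∈ A'
    · have := H ⟨x, hx⟩
      rwa [← upperProb_extProfile_coe (ord := ord) hp0 h,
        ← upperProb_extProfile_coe (ord := ord) hq0 h] at this
    · have top {s : A → ℝ} (hs : ∀ x ∉ A', s x = 0) (y : A) (hy : s y ≠ 0) :
          extProfile A' ord R' i y x :=
        extProfile_mem_notMem (by_contra fun hyA => hy (hs y hyA)) hx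
      rw [upperProb_eq_one hp (top hp0), upperProb_eq_one hq (top hq0)]

theorem extProfile_apply_eq_zero {f : (Fin n → A → A → Prop) → (A → ℝ)} (hn : 0 < n)
    (hA' : A'.Nonempty) (hord : IsPref ord) (hf : IsSDS f) (heff : SDEfficient f)
    (hR' : IsProfile R') : ∀ x ∉ A', f (extProfile A' ord R') x = 0 := by
  intro x hx
  obtain ⟨a, ha⟩ := hA'
  have hR := isProfile_extProfile (n := n) hord hR'
  refine (heff _ hR).apply_eq_zero hR (hf _ hR) ⟨a, fun i => extProfile_mem_notMem ha hx,
    ⟨0, hn⟩, extProfile_mem_notMem ha hx, not_extProfile_notMem_mem ?_ hx ha⟩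
  simp

end RestrictedLottery

/-- If `f` is an anonymous, neutral, sd-efficient and sd-strategyproof SDS for `n ≥ 4`
agents and `m ≥ 4` alternatives, and `A'` is a fixed 4-element subset of the alternatives,
then the restricted SDS `f'` for 4 agents and alternatives `A'` is well-defined
(`f` of an extended profile places all probability on `A'`), and `f'` is anonymous,
neutral, sd-efficient and sd-strategyproof. -/
theorem restriction_inherits_properties
    (hn : 4 ≤ n) (hm : 4 ≤ Fintype.card A)
    (A' : Finset A) (hA' : A'.card = 4)
    (ord : A → A → Prop) (hord : IsPref ord)
    (f : (Fin n → A → A → Prop) → (A → ℝ))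
    (hf : IsSDS f) (han : Anonymous f) (hneu : Neutral f)
    (heff : SDEfficient f) (hsp : SDStrategyproof f) :
    (∀ R' : Fin 4 → {x : A // x ∈ A'} → {x : A // x ∈ A'} → Prop, IsProfile R' →
        ∀ x : A, x ∉ A' → f (extProfile A' ord R') x = 0) ∧
    IsSDS (restrictSDS f A' ord) ∧
    Anonymous (restrictSDS f A' ord) ∧
    Neutral (restrictSDS f A' ord) ∧
    SDEfficient (restrictSDS f A' ord) ∧
    SDStrategyproof (restrictSDS f A' ord) := by
  have hsupp (R' : Fin 4 → {x : A // x ∈ A'} → {x : A // x ∈ A'} → Prop) (hR' : IsProfile R') :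
      ∀ x ∉ A', f (extProfile A' ord R') x = 0 :=
    extProfile_apply_eq_zero (by omega) (Finset.card_pos.1 (by omega)) hord hf heff hR'
  have hlot (R' : Fin 4 → {x : A // x ∈ A'} → {x : A // x ∈ A'} → Prop) (hR' : IsProfile R') :
      IsLottery (f (extProfile A' ord R')) := hf _ (isProfile_extProfile hord hR')
  refine ⟨hsupp, fun R' hR' => (hlot R' hR').restrict (hsupp R' hR'), ?_, ?_, ?_, ?_⟩
  · intro R' hR' π
    obtain ⟨τ, hτ⟩ := extProfile_comp_perm (A' := A') (ord := ord) (R' := R') hn π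
    funext x
    simp only [restrictSDS]
    rw [hτ, han _ (isProfile_extProfile hord hR')]
  · intro R' hR' σ x
    simp only [restrictSDS]
    rw [extProfile_relabel, ← Equiv.Perm.ofSubtype_apply_coe σ x]
    exact hneu _ (isProfile_extProfile hord hR') _ _
  · rintro R' hR' ⟨q', hq', hge, i, -, hlt⟩
    let q : A → ℝ := fun x => if h : x ∈ A' then q' ⟨x, h⟩ else 0
    have hq0 : ∀ x ∉ A', q x = 0 := fun x hx => by simp [q, hx]
    have hqq' : (fun x : {x : A // x ∈ A'} => q x) = q' := by funext x; simp [q]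
    have hq : IsLottery q := by
      refine ⟨fun x => ?_, ?_⟩
      · by_cases hx : x ∈ A'
        · simpa [q, hx] using hq'.1 ⟨x, hx⟩
        · simp [q, hx]
      · rw [← sum_coe_eq_sum hq0, ← hq'.2, ← hqq']
    have hge_ext (j : Fin n) : SDge (extProfile A' ord R' j) q (f (extProfile A' ord R')) := by
      by_cases h : (j : ℕ) < 4
      · rw [sdGe_extProfile_iff hq (hlot R' hR') hq0 (hsupp R' hR') h, hqq']
        exact hge _
      · exact sdGe_extProfile_of_le hq (hlot R' hR') (not_lt.1 h)
    refine heff _ (isProfile_extProfile hord hR')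
      ⟨q, hq, hge_ext, Fin.castLE hn i, hge_ext _, fun H => hlt ?_⟩
    have := (sdGe_extProfile_iff (hlot R' hR') hq (hsupp R' hR') hq0 i.2).1 H
    rwa [hqq'] at this
  · intro R₁ R₂ hR₁ hR₂ i hagree hgt
    refine hsp (extProfile A' ord R₁) (extProfile A' ord R₂) (isProfile_extProfile hord hR₁)
      (isProfile_extProfile hord hR₂) (Fin.castLE hn i) (fun j hj => ?_) ⟨?_, fun H => hgt.2 ?_⟩
    · funext x y
      by_cases h : (j : ℕ) < 4
      · have : R₁ ⟨j, h⟩ = R₂ ⟨j, h⟩ := hagree _ fun hji => hj (by ext; simp [← hji])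
        simp only [extProfile, this]
      · simp [extProfile, h]
    · exact (sdGe_extProfile_iff (hlot _ hR₂) (hlot _ hR₁) (hsupp _ hR₂) (hsupp _ hR₁) i.2).2 hgt.1
    · exact (sdGe_extProfile_iff (hlot _ hR₁) (hlot _ hR₂) (hsupp _ hR₁) (hsupp _ hR₂) i.2).1 H

end Reduction
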